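/- arXiv:1006.0152 — 9 statements merged into one kernel-verified Lean document; each statement's English description precedes it below -/
import Mathlib

section
/- Let k ≥ 1 and let A^{(0)},...,A^{(k-1)} be real matrices with A^{(j)} of size n_j × n_{j+1} (indices mod k). If the associated signed digraph G_{A^{(0)}···A^{(k-1)}} is e-cycle-free, then the n_0 × n_0 product matrix A = A^{(0)}A^{(1)}···A^{(k-1)} is a P0-matrix. -/
/-- `M` is a P0-matrix: every principal minor is nonnegative. -/
def IsP0Matrix {n : ℕ} (M : Matrix (Fin n) (Fin n) ℝ) : Prop :=
  ∀ α : Finset (Fin n),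
    0 ≤ (M.submatrix (fun i : {x // x ∈ α} => (i : Fin n))
          (fun i : {x // x ∈ α} => (i : Fin n))).det

/-- Product `A^(0) * A^(1) * ⋯ * A^(l-1)`. -/
def matProd0 (n : ℕ → ℕ) (A : ∀ j : ℕ, Matrix (Fin (n j)) (Fin (n (j + 1))) ℝ) :
    (l : ℕ) → Matrix (Fin (n 0)) (Fin (n l)) ℝ
  | 0 => 1
  | l + 1 => matProd0 n A l * A l

/-- The signed digraph associated with the list `A^(0), …, A^(k-1)` contains an e-cycle. -/
def HasECycle (k : ℕ) (n : ℕ → ℕ) (hn : n k = n 0)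
    (A : ∀ j : ℕ, Matrix (Fin (n j)) (Fin (n (j + 1))) ℝ) : Prop :=
  ∃ (m : ℕ) (v : ∀ j : ℕ, ZMod (m + 1) → Fin (n j)),
    (∀ j < k, Function.Injective (v j)) ∧
    (∀ t : ZMod (m + 1), v k t = Fin.cast hn.symm (v 0 (t + 1))) ∧
    (∀ j < k, ∀ t : ZMod (m + 1), A j (v j t) (v (j + 1) t) ≠ 0) ∧
    0 < (-1 : ℝ) ^ (m + 1) *
        ∏ t : ZMod (m + 1), ∏ j ∈ Finset.range k, A j (v j t) (v (j + 1) t)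

/-- `X` lies in the qualitative class of `M`. -/
def InQualClass {p q : ℕ} (X M : Matrix (Fin p) (Fin q) ℝ) : Prop :=
  ∀ i j, (0 < M i j → 0 < X i j) ∧ (M i j < 0 → X i j < 0) ∧ (M i j = 0 → X i j = 0)

theorem det_submatrix_mul_eq_sum {ι m q r : Type*} [Fintype ι] [DecidableEq ι] [Fintype q]
    [DecidableEq q] (P : Matrix m q ℝ) (B : Matrix q r ℝ) (e : ι → m) (g : ι → r) :
    ((P * B).submatrix e g).det =
      ∑ f : ι → q, (P.submatrix e f).det * ∏ i, B (f i) (g i) := by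
  have hrow : ((P * B).submatrix e g).transpose =
      fun i => ∑ j : q, B j (g i) • (fun a => P (e a) j) := by
    ext i a
    simp [Matrix.mul_apply, Finset.sum_apply, mul_comm]
  rw [← Matrix.det_transpose, hrow]
  change (Matrix.detRowAlternating (R := ℝ) (n := ι)).toMultilinearMap _ = _
  rw [MultilinearMap.map_sum]
  refine Finset.sum_congr rfl fun f _ => ?_
  rw [MultilinearMap.map_smul_univ, smul_eq_mul, mul_comm, ← Matrix.det_transpose]
  rfl

theorem injective_of_det_submatrix_ne_zero {ι m q : Type*} [Fintype ι] [DecidableEq ι]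
    {P : Matrix m q ℝ} {e : ι → m} {f : ι → q} (h : (P.submatrix e f).det ≠ 0) :
    Function.Injective f := by
  intro a b hab
  by_contra hne
  exact h (Matrix.det_zero_of_column_eq hne fun i => by simp [hab])

/-- A minor of the identity with distinct rows is nonzero only if its columns are a permutation
of its rows, in which case it is the sign of that permutation. -/
theorem exists_perm_of_det_one_submatrix_ne_zero {ι q : Type*} [Fintype ι] [DecidableEq ι]
    [DecidableEq q] {e f : ι → q} (he : Function.Injective e)
    (h : ((1 : Matrix q q ℝ).submatrix e f).det ≠ 0) :
    ∃ τ : Equiv.Perm ι, f = e ∘ τ ∧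
      ((1 : Matrix q q ℝ).submatrix e f).det = ((Equiv.Perm.sign τ : ℤ) : ℝ) := by
  have hf := injective_of_det_submatrix_ne_zero h
  have hmem : ∀ i, ∃ a, e a = f i := by
    intro i
    by_contra! hi
    exact h (Matrix.det_eq_zero_of_column_eq_zero i fun a => by simp [hi a])
  choose t ht using hmem
  have htinj : Function.Injective t := fun a b hab => hf (by rw [← ht, ← ht, hab])
  refine ⟨Equiv.ofBijective t (Finite.injective_iff_bijective.mp htinj), ?_, ?_⟩
  · ext i
    exact (ht i).symm
  · have hfe : f = e ∘ Equiv.ofBijective t (Finite.injective_iff_bijective.mp htinj) :=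
      funext fun i => (ht i).symm
    set τ := Equiv.ofBijective t (Finite.injective_iff_bijective.mp htinj)
    have : (1 : Matrix q q ℝ).submatrix e f = (1 : Matrix ι ι ℝ).submatrix id τ := by
      rw [hfe]
      ext a b
      simp [Matrix.one_apply, he.eq_iff]
    rw [this, Matrix.det_permute']
    simp

/-- A nonzero minor of a product has, in its Cauchy–Binet expansion, a term of its own sign: a
family of vertex-disjoint paths. -/
theorem exists_paths_of_pos_mul_det (n : ℕ → ℕ) (hpos : ∀ j, 0 < n j)
    (A : ∀ j : ℕ, Matrix (Fin (n j)) (Fin (n (j + 1))) ℝ)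
    {ι : Type*} [Fintype ι] [DecidableEq ι] (e : ι → Fin (n 0)) (he : Function.Injective e)
    (l : ℕ) (g : ι → Fin (n l)) (s : ℝ)
    (h : 0 < s * ((matProd0 n A l).submatrix e g).det) :
    ∃ (τ : Equiv.Perm ι) (v : ∀ j : ℕ, ι → Fin (n j)),
      v 0 = e ∘ τ ∧ v l = g ∧ (∀ j ≤ l, Function.Injective (v j)) ∧
      0 < s * ((Equiv.Perm.sign τ : ℤ) : ℝ) *
        ∏ i, ∏ j ∈ Finset.range l, A j (v j i) (v (j + 1) i) := by
  induction l generalizing s with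
  | zero =>
    have hne : ((1 : Matrix (Fin (n 0)) (Fin (n 0)) ℝ).submatrix e g).det ≠ 0 :=
      right_ne_zero_of_mul h.ne'
    obtain ⟨τ, hτ, hdet⟩ := exists_perm_of_det_one_submatrix_ne_zero he hne
    refine ⟨τ, Function.update (fun j _ => ⟨0, hpos j⟩) 0 g, ?_, ?_, ?_, ?_⟩
    · simp [hτ]
    · simp
    · intro j hj
      obtain rfl : j = 0 := by omega
      simpa using injective_of_det_submatrix_ne_zero hne
    · have h' : 0 < s * ((1 : Matrix (Fin (n 0)) (Fin (n 0)) ℝ).submatrix e g).det := h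
      simpa [hdet] using h'
  | succ l ih =>
    have hg := injective_of_det_submatrix_ne_zero (right_ne_zero_of_mul h.ne')
    rw [matProd0, det_submatrix_mul_eq_sum, Finset.mul_sum] at h
    obtain ⟨f, -, hf⟩ := Finset.exists_lt_of_sum_lt (s := Finset.univ) (f := fun _ => (0 : ℝ))
      (by simpa using h)
    obtain ⟨τ, v, hv0, hvl, hinj, hv⟩ := ih f (s * ∏ i, A l (f i) (g i)) (by
      linarith)
    have hlow : ∀ j ≤ l, Function.update v (l + 1) g j = v j := fun j hj =>
      Function.update_of_ne (by omega) _ _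
    refine ⟨τ, Function.update v (l + 1) g, ?_, ?_, ?_, ?_⟩
    · rw [hlow 0 (Nat.zero_le l), hv0]
    · simp
    · intro j hj
      rcases Nat.lt_or_eq_of_le hj with hj | rfl
      · rw [hlow j (by omega)]
        exact hinj j (by omega)
      · simpa using hg
    · have hprod : ∀ i, ∏ j ∈ Finset.range (l + 1), A j (Function.update v (l + 1) g j i)
          (Function.update v (l + 1) g (j + 1) i) =
          (∏ j ∈ Finset.range l, A j (v j i) (v (j + 1) i)) * A l (f i) (g i) := by
        intro i
        rw [Finset.prod_range_succ, hlow l le_rfl, hvl, Function.update_self]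
        congr 1
        refine Finset.prod_congr rfl fun j hj => ?_
        have := Finset.mem_range.mp hj
        rw [hlow j (by omega), hlow (j + 1) (by omega)]
      simp only [hprod, Finset.prod_mul_distrib]
      refine hv.trans_eq ?_
      ring

/-- A cyclic permutation enumerates its support along `ZMod`. -/
theorem Equiv.Perm.IsCycle.exists_zmod_enum {ι : Type*} [Fintype ι] [DecidableEq ι]
    {σ : Equiv.Perm ι} (hσ : σ.IsCycle) :
    ∃ (m : ℕ) (u : ZMod (m + 1) → ι), m + 1 = σ.support.card ∧ Function.Injective u ∧
      (∀ t, σ (u t) = u (t + 1)) ∧ Finset.univ.image u = σ.support := by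
  obtain ⟨x, hx, -⟩ := id hσ
  obtain ⟨m, hm⟩ : ∃ m, orderOf σ = m + 1 := ⟨orderOf σ - 1, by have := orderOf_pos σ; omega⟩
  have hcard : m + 1 = σ.support.card := by rw [← hm, hσ.orderOf]
  have hinj : Function.Injective fun t : ZMod (m + 1) => (σ ^ t.val) x := by
    intro a b hab
    have hpow : σ ^ a.val = σ ^ b.val := hσ.pow_eq_pow_iff.mpr ⟨x, hx, hab⟩
    rw [pow_inj_mod, hm, Nat.mod_eq_of_lt a.val_lt, Nat.mod_eq_of_lt b.val_lt] at hpow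
    exact ZMod.val_injective _ hpow
  refine ⟨m, fun t => (σ ^ t.val) x, hcard, hinj, fun t => ?_, ?_⟩
  · have hval : (t + 1).val = (t.val + 1) % orderOf σ := by
      rw [ZMod.val_add, hm, ZMod.val_one_eq_one_mod, Nat.add_mod_mod]
    change σ ((σ ^ t.val) x) = (σ ^ (t + 1).val) x
    rw [hval, pow_mod_orderOf, pow_succ', Equiv.Perm.mul_apply]
  · refine Finset.eq_of_subset_of_card_le ?_ ?_
    · intro y hy
      obtain ⟨t, -, rfl⟩ := Finset.mem_image.mp hy
      exact Equiv.Perm.pow_apply_mem_support.mpr (Equiv.Perm.mem_support.mpr hx)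
    · rw [Finset.card_image_of_injective _ hinj, Finset.card_univ, ZMod.card, hcard]

theorem sign_mul_prod_support_nonneg {ι : Type*} [Fintype ι] [DecidableEq ι] (w : ι → ℝ)
    (ρ : Equiv.Perm ι)
    (h : ∀ (m : ℕ) (u : ZMod (m + 1) → ι), Function.Injective u → (∀ t, u t ∈ ρ.support) →
      (∀ t, ρ (u t) = u (t + 1)) → (-1 : ℝ) ^ (m + 1) * ∏ t, w (u t) ≤ 0) :
    0 ≤ ((Equiv.Perm.sign ρ : ℤ) : ℝ) * ∏ i ∈ ρ.support, w i := by
  induction ρ using Equiv.Perm.cycle_induction_on with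
  | base_one => simp
  | base_cycles σ hσ =>
    obtain ⟨m, u, hcard, hinj, hstep, himage⟩ := hσ.exists_zmod_enum
    have := h m u hinj (fun t => himage ▸ Finset.mem_image_of_mem u (Finset.mem_univ t)) hstep
    rw [hσ.sign, ← hcard, ← himage, Finset.prod_image hinj.injOn]
    push_cast
    linarith
  | induction_disjoint σ τ hd _ hσ hτ =>
    have hσ' := hσ fun m u hu hmem hstep => h m u hu
      (fun t => by rw [hd.support_mul]; exact Finset.mem_union_left _ (hmem t)) fun t => by
        have := (hd (u t)).resolve_left (Equiv.Perm.mem_support.mp (hmem t))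
        rw [Equiv.Perm.mul_apply, this, hstep]
    have hτ' := hτ fun m u hu hmem hstep => h m u hu
      (fun t => by rw [hd.support_mul]; exact Finset.mem_union_right _ (hmem t)) fun t => by
        have := (hd (u (t + 1))).resolve_right (Equiv.Perm.mem_support.mp (hmem (t + 1)))
        rw [Equiv.Perm.mul_apply, hstep, this]
    rw [hd.support_mul, Finset.prod_union hd.disjoint_support, Equiv.Perm.sign_mul]
    push_cast
    refine (mul_nonneg hσ' hτ').trans_eq ?_
    ring

theorem exists_cycle_of_sign_mul_prod_neg {ι : Type*} [Fintype ι] [DecidableEq ι] (w : ι → ℝ)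
    (ρ : Equiv.Perm ι) (h : ((Equiv.Perm.sign ρ : ℤ) : ℝ) * ∏ i, w i < 0) :
    ∃ (m : ℕ) (u : ZMod (m + 1) → ι), Function.Injective u ∧ (∀ t, ρ (u t) = u (t + 1)) ∧
      0 < (-1 : ℝ) ^ (m + 1) * ∏ t, w (u t) := by
  by_contra! hno
  have hsupp := sign_mul_prod_support_nonneg w ρ fun m u hu _ hstep => hno m u hu hstep
  have hfix : 0 ≤ ∏ i ∈ ρ.supportᶜ, w i := by
    refine Finset.prod_nonneg fun i hi => ?_
    have hi' : ρ i = i := Equiv.Perm.notMem_support.mp (Finset.mem_compl.mp hi)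
    have : Subsingleton (ZMod (0 + 1)) := inferInstanceAs (Subsingleton (Fin 1))
    have := hno 0 (fun _ => i) (Function.injective_of_subsingleton _) (fun _ => hi')
    simpa using this
  rw [← Finset.prod_mul_prod_compl ρ.support, ← mul_assoc] at h
  exact absurd (mul_nonneg hsupp hfix) (not_le.mpr h)

theorem stmt0 (k : ℕ) (hk : 1 ≤ k) (n : ℕ → ℕ) (hpos : ∀ j, 0 < n j)
    (hn : n k = n 0)
    (A : ∀ j : ℕ, Matrix (Fin (n j)) (Fin (n (j + 1))) ℝ)
    (hfree : ¬ HasECycle k n hn A) :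
    IsP0Matrix ((matProd0 n A k).submatrix id (Fin.cast hn.symm)) := by
  intro α
  by_contra! hneg
  rw [Matrix.submatrix_submatrix] at hneg
  obtain ⟨τ, v, hv0, hvk, hinj, hv⟩ := exists_paths_of_pos_mul_det n hpos A
    (id ∘ fun i : {x // x ∈ α} => (i : Fin (n 0))) Subtype.val_injective k _ (-1)
    (by linarith)
  obtain ⟨m, u, hu, hstep, hprod⟩ := exists_cycle_of_sign_mul_prod_neg
    (fun i => ∏ j ∈ Finset.range k, A j (v j i) (v (j + 1) i)) τ⁻¹
    (by rw [Equiv.Perm.sign_inv]; linarith)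
  refine hfree ⟨m, fun j t => v j (u t), fun j hj => (hinj j hj.le).comp hu, fun t => ?_,
    fun j hj t => ?_, hprod⟩
  · simp [hvk, hv0, ← hstep]
  · have := Finset.prod_ne_zero_iff.mp (right_ne_zero_of_mul hv.ne') (u t) (Finset.mem_univ _)
    exact Finset.prod_ne_zero_iff.mp this j (Finset.mem_range.mpr hj)
end

section
/- Let A be an n×n real matrix. If the signed digraph G_A is e-cycle-free, then A is a P0-matrix. -/
/-- The signed digraph `G_A` of the square matrix `A` contains an e-cycle:
a cycle through distinct vertices `v 0, v 1, …` of some length `m + 1 ≥ 1`, all of whose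
edges correspond to nonzero entries of `A`, such that `(-1)^(m+1)` times the product of
the corresponding entries is positive. -/
def HasECycleSq {n : ℕ} (A : Matrix (Fin n) (Fin n) ℝ) : Prop :=
  ∃ (m : ℕ) (v : ZMod (m + 1) → Fin n),
    Function.Injective v ∧
    (∀ t : ZMod (m + 1), A (v t) (v (t + 1)) ≠ 0) ∧
    0 < (-1 : ℝ) ^ (m + 1) * ∏ t : ZMod (m + 1), A (v t) (v (t + 1))

open Equiv Perm in
/-- In an e-cycle-free signed digraph, a cyclic permutation contributes a nonnegative
signed product of entries over its support. -/
theorem sign_mul_prod_support_nonneg_of_isCycle {n : ℕ} {A : Matrix (Fin n) (Fin n) ℝ}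
    (hfree : ¬ HasECycleSq A) {σ : Perm (Fin n)} (hσ : σ.IsCycle) :
    0 ≤ ((sign σ : ℤ) : ℝ) * ∏ i ∈ σ.support, A i (σ i) := by
  by_cases h0 : ∃ i ∈ σ.support, A i (σ i) = 0
  · obtain ⟨i, hi, hi0⟩ := h0
    rw [Finset.prod_eq_zero hi hi0, mul_zero]
  push Not at h0
  obtain ⟨x, hx, -⟩ := id hσ
  obtain ⟨m, hm⟩ : ∃ m, orderOf σ = m + 1 :=
    Nat.exists_eq_succ_of_ne_zero (orderOf_pos σ).ne'
  let v : ZMod (m + 1) → Fin n := fun t => (σ ^ t.val) x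
  have hinj : Function.Injective v := by
    intro a b hab
    apply ZMod.val_injective
    refine pow_injOn_Iio_orderOf (x := σ) ?_ ?_ (hσ.pow_eq_pow_iff.2 ⟨x, hx, hab⟩)
    · simpa [hm] using a.val_lt
    · simpa [hm] using b.val_lt
  have hsucc : ∀ t, v (t + 1) = σ (v t) := by
    intro t
    have ht : (t + 1).val = (t.val + 1) % orderOf σ := by
      rw [hm, ZMod.val_add, ZMod.val_one_eq_one_mod, Nat.add_mod_mod]
    simp only [v]
    rw [ht, pow_mod_orderOf, pow_succ', mul_apply]
  have hmem : ∀ t, v t ∈ σ.support := fun t =>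
    pow_apply_mem_support.2 (mem_support.2 hx)
  have himage : Finset.univ.image v = σ.support := by
    apply Finset.eq_of_subset_of_card_le
    · simpa [Finset.subset_iff] using fun t => mem_support.1 (hmem t)
    · rw [Finset.card_image_of_injective _ hinj, Finset.card_univ, ZMod.card, ← hσ.orderOf, hm]
  have hprod : ∏ i ∈ σ.support, A i (σ i) = ∏ t, A (v t) (v (t + 1)) := by
    rw [← himage, Finset.prod_image hinj.injOn]
    simp only [hsucc]
  have hle : (-1 : ℝ) ^ (m + 1) * ∏ t, A (v t) (v (t + 1)) ≤ 0 := by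
    by_contra! hpos
    exact hfree ⟨m, v, hinj, fun t => hsucc t ▸ h0 _ (hmem t), hpos⟩
  rw [hprod, hσ.sign, ← hσ.orderOf, hm]
  push_cast
  linarith

open Equiv Perm in
/-- In an e-cycle-free signed digraph, every permutation contributes a nonnegative
signed product of entries over its support. -/
theorem sign_mul_prod_support_nonneg_s1 {n : ℕ} {A : Matrix (Fin n) (Fin n) ℝ}
    (hfree : ¬ HasECycleSq A) (σ : Perm (Fin n)) :
    0 ≤ ((sign σ : ℤ) : ℝ) * ∏ i ∈ σ.support, A i (σ i) := by
  induction σ using cycle_induction_on with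
  | base_one => simp
  | base_cycles σ hσ => exact sign_mul_prod_support_nonneg_of_isCycle hfree hσ
  | induction_disjoint σ τ hd _ hσ hτ =>
    have h₁ : ∏ i ∈ σ.support, A i ((σ * τ) i) = ∏ i ∈ σ.support, A i (σ i) :=
      Finset.prod_congr rfl fun i hi => by
        rw [mul_apply, (hd i).resolve_left (mem_support.1 hi)]
    have h₂ : ∏ i ∈ τ.support, A i ((σ * τ) i) = ∏ i ∈ τ.support, A i (τ i) :=
      Finset.prod_congr rfl fun i hi => by
        rw [hd.commute.eq, mul_apply, (hd i).resolve_right (mem_support.1 hi)]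
    rw [hd.support_mul, Finset.prod_union hd.disjoint_support, h₁, h₂, Perm.sign_mul]
    push_cast
    rw [mul_mul_mul_comm]
    exact mul_nonneg hσ hτ

/-- The diagonal entries are the entries of the loops, so they are nonnegative in the
absence of e-cycles. -/
theorem diag_nonneg_of_not_hasECycleSq {n : ℕ} {A : Matrix (Fin n) (Fin n) ℝ}
    (hfree : ¬ HasECycleSq A) (i : Fin n) : 0 ≤ A i i := by
  by_contra! hneg
  refine hfree ⟨0, fun _ => i, fun a b _ => Subsingleton.elim (α := Fin 1) a b,
    fun _ => hneg.ne, ?_⟩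
  simpa using hneg

theorem stmt1 {n : ℕ} (A : Matrix (Fin n) (Fin n) ℝ) (hfree : ¬ HasECycleSq A) :
    IsP0Matrix A := by
  intro α
  rw [← Matrix.det_transpose, Matrix.det_apply']
  refine Finset.sum_nonneg fun σ _ => ?_
  simp only [Matrix.transpose_apply, Matrix.submatrix_apply]
  set τ : Equiv.Perm (Fin n) := Equiv.Perm.ofSubtype σ with hτ
  have hprod : ∏ i : {x // x ∈ α}, A (i : Fin n) (σ i : Fin n) = ∏ i ∈ α, A i (τ i) := by
    rw [← Finset.prod_coe_sort α]
    exact Finset.prod_congr rfl fun i _ => by rw [hτ, Equiv.Perm.ofSubtype_apply_coe]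
  have hsub : τ.support ⊆ α := by
    intro i hi
    by_contra hiα
    exact Equiv.Perm.mem_support.1 hi (Equiv.Perm.ofSubtype_apply_of_not_mem σ hiα)
  rw [hprod, ← Equiv.Perm.sign_ofSubtype σ, ← Finset.prod_sdiff hsub, mul_left_comm]
  refine mul_nonneg (Finset.prod_nonneg fun i hi => ?_) (sign_mul_prod_support_nonneg_s1 hfree τ)
  rw [Equiv.Perm.notMem_support.1 (Finset.mem_sdiff.1 hi).2]
  exact diag_nonneg_of_not_hasECycleSq hfree i
end

section
/- Let A be a real n×p matrix and B a real p×n matrix. Suppose that for every integer m ≥ 1 and all injective maps u : Z/mZ → {1,...,n} and w : Z/mZ → {1,...,p} with A_{u(t),w(t)} ≠ 0 and B_{w(t),u(t+1)} ≠ 0 for all t ∈ Z/mZ, it is NOT the case that (-1)^m · ∏_{t∈Z/mZ} A_{u(t),w(t)} B_{w(t),u(t+1)} > 0. Then the n×n product AB is a P0-matrix. -/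
/-- If the product of nonzero weights along every cycle of `σ` has the sign of that cycle, then
the product of the weights over the support of `σ` has the sign of `σ`. -/
theorem Equiv.Perm.sign_mul_prod_support_pos {α : Type*} [Fintype α] [DecidableEq α]
    (c : α → ℝ) (σ : Equiv.Perm α)
    (h : ∀ (m : ℕ) (u : ZMod (m + 1) → α), Function.Injective u →
      (∀ t, u t ∈ σ.support) → (∀ t, u (t + 1) = σ (u t)) →
      0 < (-1 : ℝ) ^ m * ∏ t, c (u t)) :
    0 < ((Equiv.Perm.sign σ : ℤ) : ℝ) * ∏ i ∈ σ.support, c i := by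
  induction σ using Equiv.Perm.cycle_induction_on with
  | base_one => simp
  | base_cycles σ hσ =>
    obtain ⟨x, hx, -⟩ := id hσ
    obtain ⟨m, hm⟩ : ∃ m, orderOf σ = m + 1 :=
      Nat.exists_eq_succ_of_ne_zero (orderOf_pos σ).ne'
    have hcard : σ.support.card = m + 1 := by rw [← hσ.orderOf, hm]
    let u : ZMod (m + 1) → α := fun t => (σ ^ t.val) x
    have hinj : Function.Injective u := by
      intro a b hab
      have hpow : σ ^ a.val = σ ^ b.val := hσ.pow_eq_pow_iff.2 ⟨x, hx, hab⟩
      apply ZMod.val_injective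
      exact pow_injOn_Iio_orderOf (by simpa [hm] using a.val_lt) (by simpa [hm] using b.val_lt) hpow
    have hsupp : ∀ t, u t ∈ σ.support := fun t =>
      Equiv.Perm.pow_apply_mem_support.2 (Equiv.Perm.mem_support.2 hx)
    have hstep : ∀ t, u (t + 1) = σ (u t) := by
      intro t
      have hval : σ ^ (t + 1).val = σ ^ (t.val + 1) := by
        have hmod : ∀ k : ℕ, σ ^ (k % (m + 1)) = σ ^ k := fun k => by rw [← hm, pow_mod_orderOf]
        rw [ZMod.val_add, hmod, pow_add, pow_add, ZMod.val_one_eq_one_mod, hmod]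
      simp only [u, hval, pow_succ', Equiv.Perm.mul_apply]
    have himage : Finset.univ.image u = σ.support := by
      apply Finset.eq_of_subset_of_card_le
      · intro i hi
        obtain ⟨t, -, rfl⟩ := Finset.mem_image.1 hi
        exact hsupp t
      · rw [Finset.card_image_of_injective _ hinj, hcard, Finset.card_univ, ZMod.card]
    have := h m u hinj hsupp hstep
    rw [← himage, Finset.prod_image hinj.injOn, hσ.sign, hcard]
    simpa [pow_succ] using this
  | induction_disjoint σ τ hd _ hσ hτ =>
    have h₁ := hσ fun m u hu hmem hstep => h m u hu
      (fun t => by rw [hd.support_mul]; exact Finset.mem_union_left _ (hmem t))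
      (fun t => by
        rw [Equiv.Perm.mul_apply, (hd (u t)).resolve_left (Equiv.Perm.mem_support.1 (hmem t)),
          hstep])
    have h₂ := hτ fun m u hu hmem hstep => h m u hu
      (fun t => by rw [hd.support_mul]; exact Finset.mem_union_right _ (hmem t))
      (fun t => by
        rw [hd.commute.eq, Equiv.Perm.mul_apply,
          (hd (u t)).resolve_right (Equiv.Perm.mem_support.1 (hmem t)), hstep])
    rw [hd.support_mul, Finset.prod_union hd.disjoint_support, Equiv.Perm.sign_mul]
    push_cast
    rw [mul_mul_mul_comm]
    exact mul_pos h₁ h₂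

/-- If the product of nonzero weights along every cycle of `σ`, fixed points included, has the
sign of that cycle, then the product of all weights has the sign of `σ`. -/
theorem Equiv.Perm.sign_mul_prod_pos {α : Type*} [Fintype α] [DecidableEq α]
    (c : α → ℝ) (σ : Equiv.Perm α)
    (h : ∀ (m : ℕ) (u : ZMod (m + 1) → α), Function.Injective u →
      (∀ t, u (t + 1) = σ (u t)) → 0 < (-1 : ℝ) ^ m * ∏ t, c (u t)) :
    0 < ((Equiv.Perm.sign σ : ℤ) : ℝ) * ∏ i, c i := by
  rw [← Finset.prod_mul_prod_compl σ.support, ← mul_assoc]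
  refine mul_pos (σ.sign_mul_prod_support_pos c fun m u hu _ => h m u hu)
    (Finset.prod_pos fun i hi => ?_)
  have hfix : σ i = i := by simpa using hi
  have hsub : Subsingleton (ZMod (0 + 1)) := inferInstanceAs (Subsingleton (Fin 1))
  have := h 0 (fun _ => i) (Function.injective_of_subsingleton _) fun _ => hfix.symm
  simpa using this

/-- The determinant of a product, expanded over the intermediate indices. -/
theorem Matrix.det_mul_eq_sum_prod_mul_det {α κ R : Type*} [Fintype α] [DecidableEq α]
    [Fintype κ] [CommRing R] (A : Matrix α κ R) (B : Matrix κ α R) :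
    (A * B).det = ∑ f : α → κ, (∏ i, A i (f i)) * (B.submatrix f id).det := by
  classical
  simp only [← Matrix.det_transpose (A * B), ← Matrix.det_transpose (B.submatrix _ id),
    Matrix.det_apply', Matrix.transpose_apply, Matrix.mul_apply, Matrix.submatrix_apply, id,
    Finset.prod_univ_sum, Finset.mul_sum, Fintype.piFinset_univ, Finset.prod_mul_distrib]
  rw [Finset.sum_comm]
  refine Finset.sum_congr rfl fun f _ => Finset.sum_congr rfl fun σ _ => ?_
  ring

theorem stmt2 {n p : ℕ} (A : Matrix (Fin n) (Fin p) ℝ) (B : Matrix (Fin p) (Fin n) ℝ)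
    (hfree : ∀ (m : ℕ) (u : ZMod (m + 1) → Fin n) (w : ZMod (m + 1) → Fin p),
      Function.Injective u → Function.Injective w →
      (∀ t : ZMod (m + 1), A (u t) (w t) ≠ 0) →
      (∀ t : ZMod (m + 1), B (w t) (u (t + 1)) ≠ 0) →
      ¬ (0 < (-1 : ℝ) ^ (m + 1) *
            ∏ t : ZMod (m + 1), A (u t) (w t) * B (w t) (u (t + 1)))) :
    IsP0Matrix (A * B) := by
  intro α
  change 0 ≤ (A.submatrix (fun i : {x // x ∈ α} => (i : Fin n)) id *
    B.submatrix id (fun i : {x // x ∈ α} => (i : Fin n))).det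
  rw [Matrix.det_mul_eq_sum_prod_mul_det]
  refine Finset.sum_nonneg fun f _ => ?_
  by_cases hf : Function.Injective f
  swap
  · obtain ⟨i, j, hij, hne⟩ := Function.not_injective_iff.1 hf
    rw [Matrix.det_zero_of_row_eq hne (by ext k; simp [hij]), mul_zero]
  rw [← Matrix.det_transpose, Matrix.det_apply', Finset.mul_sum]
  refine Finset.sum_nonneg fun σ _ => ?_
  let c : {x // x ∈ α} → ℝ := fun i => A i (f i) * B (f i) (σ i)
  have hterm : (∏ i : {x // x ∈ α}, A i (f i)) *
      (((Equiv.Perm.sign σ : ℤ) : ℝ) * ∏ i : {x // x ∈ α}, B (f i) (σ i)) =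
      ((Equiv.Perm.sign σ : ℤ) : ℝ) * ∏ i, c i := by
    simp only [c, Finset.prod_mul_distrib]
    ring
  refine le_of_le_of_eq ?_ hterm.symm
  by_cases hc : ∏ i, c i = 0
  · rw [hc, mul_zero]
  have hne : ∀ i, c i ≠ 0 := fun i => Finset.prod_ne_zero_iff.1 hc i (Finset.mem_univ i)
  refine (σ.sign_mul_prod_pos c fun m u hu hstep => ?_).le
  have hcycle := hfree m (fun t => u t) (fun t => f (u t))
    (Subtype.val_injective.comp hu) (hf.comp hu) (fun t => left_ne_zero_of_mul (hne (u t)))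
    (fun t => by rw [hstep]; exact right_ne_zero_of_mul (hne (u t)))
  have hprod : ∏ t, A (u t) (f (u t)) * B (f (u t)) (u (t + 1)) = ∏ t, c (u t) := by
    simp only [c, hstep]
  rw [hprod, pow_succ, not_lt] at hcycle
  refine lt_of_le_of_ne (by linarith) (Ne.symm ?_)
  exact mul_ne_zero (by simp) (Finset.prod_ne_zero_iff.2 fun t _ => hne (u t))
end

section
/- Let k ≥ 1 and let A^{(0)},...,A^{(k-1)} be real matrices with A^{(j)} of size n_j × n_{j+1} (indices mod k), such that the associated signed digraph G_{A^{(0)}···A^{(k-1)}} is e-cycle-free. Then for every choice of matrices B^{(j)} ∈ Q(A^{(j)}) for j = 0,...,k-1, the product B^{(0)}B^{(1)}···B^{(k-1)} is a P0-matrix. -/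
theorem InQualClass.sign_eq {p q : ℕ} {X M : Matrix (Fin p) (Fin q) ℝ} (h : InQualClass X M)
    (i : Fin p) (j : Fin q) : SignType.sign (X i j) = SignType.sign (M i j) := by
  obtain ⟨h1, h2, h3⟩ := h i j
  rcases lt_trichotomy (M i j) 0 with hM | hM | hM
  · rw [sign_neg hM, sign_neg (h2 hM)]
  · rw [hM, h3 hM]
  · rw [sign_pos hM, sign_pos (h1 hM)]

/-- A product of entries indexed by a cycle in a graph without e-cycles has the sign of an
o-cycle, and this persists within qualitative classes. -/
theorem cycle_prod_nonneg {k : ℕ} {n : ℕ → ℕ} {hn : n k = n 0}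
    {A B : ∀ j : ℕ, Matrix (Fin (n j)) (Fin (n (j + 1))) ℝ}
    (hfree : ¬ HasECycle k n hn A) (hB : ∀ j < k, InQualClass (B j) (A j))
    {m : ℕ} (v : ∀ j : ℕ, ZMod (m + 1) → Fin (n j))
    (hinj : ∀ j < k, Function.Injective (v j))
    (hv : ∀ t : ZMod (m + 1), v k t = Fin.cast hn.symm (v 0 (t + 1))) :
    0 ≤ (-1 : ℝ) ^ m *
      ∏ t : ZMod (m + 1), ∏ j ∈ Finset.range k, B j (v j t) (v (j + 1) t) := by
  by_cases hz : ∀ j < k, ∀ t : ZMod (m + 1), A j (v j t) (v (j + 1) t) ≠ 0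
  · by_contra hneg
    refine hfree ⟨m, v, hinj, hv, hz, ?_⟩
    have hpos : 0 < (-1 : ℝ) ^ (m + 1) *
        ∏ t : ZMod (m + 1), ∏ j ∈ Finset.range k, B j (v j t) (v (j + 1) t) := by
      rw [pow_succ]
      linarith
    rw [← sign_eq_one_iff] at hpos ⊢
    rw [← hpos]
    simp only [sign_mul]
    congr 1
    change signHom (_ : ℝ) = signHom (_ : ℝ)
    rw [map_prod, map_prod]
    refine Finset.prod_congr rfl fun t _ => ?_
    rw [map_prod, map_prod]
    refine Finset.prod_congr rfl fun j hj => ?_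
    exact ((hB j (Finset.mem_range.mp hj)).sign_eq _ _).symm
  · push Not at hz
    obtain ⟨j, hj, t, ht⟩ := hz
    rw [Finset.prod_eq_zero (Finset.mem_univ t)
      (Finset.prod_eq_zero (Finset.mem_range.mpr hj) (((hB j hj) _ _).2.2 ht)), mul_zero]

theorem Equiv.Perm.IsCycle.sign_mul_prod_nonneg {α : Type*} [Fintype α] [DecidableEq α]
    {σ : Equiv.Perm α} (hσ : σ.IsCycle) (W : α → ℝ)
    (h : ∀ (m : ℕ) (u : ZMod (m + 1) → α), Function.Injective u → (∀ t, u t ∈ σ.support) →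
      (∀ t, u (t + 1) = σ (u t)) → 0 ≤ (-1 : ℝ) ^ m * ∏ t, W (u t)) :
    0 ≤ ((Equiv.Perm.sign σ : ℤ) : ℝ) * ∏ x ∈ σ.support, W x := by
  obtain ⟨x, hx, hxy⟩ := id hσ
  obtain ⟨m, hm⟩ : ∃ m, orderOf σ = m + 1 :=
    Nat.exists_eq_succ_of_ne_zero (orderOf_pos σ).ne'
  have hcard : σ.support.card = m + 1 := by rw [← hσ.orderOf, hm]
  have hstep : ∀ t : ZMod (m + 1), (σ ^ (t + 1).val) x = σ ((σ ^ t.val) x) := by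
    intro t
    rw [← Equiv.Perm.mul_apply, ← pow_succ', ← pow_mod_orderOf σ (t.val + 1), hm, ← ZMod.val_natCast,
      Nat.cast_add, ZMod.natCast_zmod_val, Nat.cast_one]
  have hmem : ∀ t : ZMod (m + 1), (σ ^ t.val) x ∈ σ.support := fun t =>
    Equiv.Perm.pow_apply_mem_support.mpr (Equiv.Perm.mem_support.mpr hx)
  have hsurj : ∀ y ∈ σ.support, ∃ t : ZMod (m + 1), (σ ^ t.val) x = y := by
    intro y hy
    obtain ⟨i, hi, hiy⟩ := (hxy (Equiv.Perm.mem_support.mp hy)).exists_pow_eq'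
    refine ⟨(i : ZMod (m + 1)), ?_⟩
    rw [ZMod.val_natCast, ← hm, pow_mod_orderOf, hiy]
  have himg : Finset.univ.image (fun t : ZMod (m + 1) => (σ ^ t.val) x) = σ.support := by
    ext y
    simp only [Finset.mem_image, Finset.mem_univ, true_and]
    exact ⟨fun ⟨t, ht⟩ => ht ▸ hmem t, hsurj y⟩
  have hinj : Function.Injective (fun t : ZMod (m + 1) => (σ ^ t.val) x) := by
    rw [← Set.injOn_univ, ← Finset.coe_univ, ← Finset.card_image_iff, himg, hcard,
      Finset.card_univ, ZMod.card]
  have key := h m _ hinj hmem hstep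
  rw [← himg, Finset.prod_image (fun a _ b _ hab => hinj hab), hσ.sign, hcard, pow_succ]
  simpa using key

/-- If every cycle of `σ`, weighted by `W`, has product of the sign of that cycle, then the signed
product of all the weights is nonnegative. -/
theorem Equiv.Perm.sign_mul_prod_nonneg {α : Type*} [Fintype α] [DecidableEq α]
    (σ : Equiv.Perm α) (W : α → ℝ)
    (h : ∀ (m : ℕ) (u : ZMod (m + 1) → α), Function.Injective u →
      (∀ t, u (t + 1) = σ (u t)) → 0 ≤ (-1 : ℝ) ^ m * ∏ t, W (u t)) :
    0 ≤ ((Equiv.Perm.sign σ : ℤ) : ℝ) * ∏ x, W x := by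
  have hsupp : ∀ τ : Equiv.Perm α, (∀ x ∈ τ.support, τ x = σ x) →
      0 ≤ ((Equiv.Perm.sign τ : ℤ) : ℝ) * ∏ x ∈ τ.support, W x := by
    intro τ
    induction τ using Equiv.Perm.cycle_induction_on with
    | base_one => simp
    | base_cycles τ hτ =>
      intro hτσ
      exact hτ.sign_mul_prod_nonneg W fun m u hu hmem hstep =>
        h m u hu fun t => by rw [hstep, hτσ _ (hmem t)]
    | induction_disjoint τ ρ hd hc ih1 ih2 =>
      intro hτσ
      rw [hd.support_mul] at hτσ
      have h1 := ih1 fun x hx => by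
        rw [← hτσ x (Finset.mem_union_left _ hx), Equiv.Perm.mul_apply]
        rcases hd x with hx' | hx'
        · exact absurd hx' (Equiv.Perm.mem_support.mp hx)
        · rw [hx']
      have h2 := ih2 fun x hx => by
        rw [← hτσ x (Finset.mem_union_right _ hx), hd.commute.eq, Equiv.Perm.mul_apply]
        rcases hd x with hx' | hx'
        · rw [hx']
        · exact absurd hx' (Equiv.Perm.mem_support.mp hx)
      rw [hd.support_mul, Finset.prod_union hd.disjoint_support, Equiv.Perm.sign_mul]
      push_cast
      calc (0 : ℝ) ≤ _ := mul_nonneg h1 h2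
        _ = _ := by ring
  have hfix : 0 ≤ ∏ x ∈ σ.supportᶜ, W x := by
    refine Finset.prod_nonneg fun x hx => ?_
    have hx' : σ x = x := by simpa using hx
    have : Subsingleton (ZMod (0 + 1)) := inferInstanceAs (Subsingleton (Fin 1))
    simpa using h 0 (fun _ => x) (Function.injective_of_subsingleton _) fun _ => hx'.symm
  rw [← Finset.prod_mul_prod_compl σ.support W, ← mul_assoc]
  exact mul_nonneg (hsupp σ fun _ _ => rfl) hfix

/-- Expansion of a minor of a product along the columns of the right factor. -/
theorem Matrix.det_submatrix_mul {R ι l m p : Type*} [CommRing R] [Fintype ι] [DecidableEq ι]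
    [Fintype m] (P : Matrix l m R) (A : Matrix m p R) (e : ι → l) (c : ι → p) :
    ((P * A).submatrix e c).det =
      ∑ f : ι → m, (∏ i, A (f i) (c i)) * (P.submatrix e f).det := by
  classical
  have hrow : ((P * A).submatrix e c).transpose =
      fun i => ∑ x : m, A x (c i) • (fun i' => P (e i') x) := by
    ext i i'
    simp [Matrix.mul_apply, Finset.sum_apply, mul_comm]
  rw [← Matrix.det_transpose, hrow]
  change Matrix.detRowAlternating.toMultilinearMap _ = _
  rw [MultilinearMap.map_sum]
  refine Finset.sum_congr rfl fun f _ => ?_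
  rw [MultilinearMap.map_smul_univ, smul_eq_mul, ← Matrix.det_transpose (P.submatrix e f)]
  rfl

/-- A closed system of paths in an e-cycle-free graph contributes nonnegatively to a principal
minor. -/
theorem pathSystem_nonneg {k : ℕ} {n : ℕ → ℕ} {hn : n k = n 0}
    {A B : ∀ j : ℕ, Matrix (Fin (n j)) (Fin (n (j + 1))) ℝ}
    (hfree : ¬ HasECycle k n hn A) (hB : ∀ j < k, InQualClass (B j) (A j))
    {ι : Type*} [Fintype ι] [DecidableEq ι] (e : ι → Fin (n 0)) (he : Function.Injective e)
    (l : ℕ) (hl : l ≤ k) (v : ∀ j : ℕ, ι → Fin (n j))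
    (hinj : ∀ j < k, l ≤ j → Function.Injective (v j))
    (hv : ∀ i, v k i = Fin.cast hn.symm (e i)) :
    0 ≤ (∏ j ∈ Finset.Ico l k, ∏ i, B j (v j i) (v (j + 1) i)) *
      ((matProd0 n B l).submatrix e (v l)).det := by
  induction l generalizing v with
  | zero =>
    by_cases hrange : ∀ i, ∃ i', e i' = v 0 i
    · choose π hπ using hrange
      have hv0 : Function.Injective (v 0) := by
        rcases Nat.eq_zero_or_pos k with rfl | hk
        · intro a b hab
          rw [hv, hv] at hab
          exact he (Fin.cast_injective _ hab)
        · exact hinj 0 hk le_rfl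
      have hπinj : Function.Injective π := fun a b hab => hv0 (by rw [← hπ, ← hπ, hab])
      let ρ : Equiv.Perm ι := Equiv.ofBijective π (Finite.injective_iff_bijective.mp hπinj)
      have hρ : ∀ i, e (ρ i) = v 0 i := hπ
      have hdet : ((matProd0 n B 0).submatrix e (v 0)).det =
          ((Equiv.Perm.sign ρ⁻¹ : ℤ) : ℝ) := by
        have : (matProd0 n B 0).submatrix e (v 0) =
            (1 : Matrix ι ι ℝ).submatrix id ρ := by
          ext i i'
          simp only [matProd0, Matrix.submatrix_apply, Matrix.one_apply, id, ← hρ, he.eq_iff]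
        rw [this, Matrix.det_permute', Matrix.det_one, mul_one, Equiv.Perm.sign_inv]
      rw [hdet, mul_comm, Finset.prod_comm, ← Finset.range_eq_Ico]
      refine Equiv.Perm.sign_mul_prod_nonneg ρ⁻¹
        (fun i => ∏ j ∈ Finset.range k, B j (v j i) (v (j + 1) i)) fun m u hu hstep => ?_
      refine cycle_prod_nonneg hfree hB (fun j t => v j (u t))
        (fun j hj => (hinj j hj (Nat.zero_le j)).comp hu) fun t => ?_
      rw [hv, hstep, ← hρ]
      simp
    · push Not at hrange
      obtain ⟨i, hi⟩ := hrange
      rw [Matrix.det_eq_zero_of_column_eq_zero i, mul_zero]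
      intro i'
      simp [matProd0, Matrix.one_apply_ne (hi i')]
  | succ l ih =>
    have hlk : l < k := hl
    rw [matProd0, Matrix.det_submatrix_mul, Finset.mul_sum]
    refine Finset.sum_nonneg fun f _ => ?_
    by_cases hf : Function.Injective f
    · have := ih hlk.le (Function.update v l f) ?_ ?_
      · have hw : ∏ j ∈ Finset.Ico (l + 1) k,
              ∏ i, B j (Function.update v l f j i) (Function.update v l f (j + 1) i) =
            ∏ j ∈ Finset.Ico (l + 1) k, ∏ i, B j (v j i) (v (j + 1) i) := by
          refine Finset.prod_congr rfl fun j hj => ?_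
          have := (Finset.mem_Ico.mp hj).1
          rw [Function.update_of_ne (by omega), Function.update_of_ne (by omega)]
        rw [Finset.prod_eq_prod_Ico_succ_bot hlk, hw, Function.update_self,
          Function.update_of_ne (Nat.succ_ne_self l)] at this
        rwa [← mul_assoc, mul_comm (∏ j ∈ Finset.Ico (l + 1) k, _)]
      · intro j hj hlj
        rcases hlj.eq_or_lt with rfl | hlt
        · rwa [Function.update_self]
        · rw [Function.update_of_ne hlt.ne']
          exact hinj j hj hlt
      · rw [Function.update_of_ne hlk.ne']
        exact hv
    · obtain ⟨a, b, hab, hne⟩ := Function.not_injective_iff.mp hf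
      rw [Matrix.det_zero_of_column_eq hne (fun i => by simp [hab]), mul_zero, mul_zero]

theorem stmt3 (k : ℕ) (hk : 1 ≤ k) (n : ℕ → ℕ) (hpos : ∀ j, 0 < n j)
    (hn : n k = n 0)
    (A : ∀ j : ℕ, Matrix (Fin (n j)) (Fin (n (j + 1))) ℝ)
    (hfree : ¬ HasECycle k n hn A)
    (B : ∀ j : ℕ, Matrix (Fin (n j)) (Fin (n (j + 1))) ℝ)
    (hB : ∀ j < k, InQualClass (B j) (A j)) :
    IsP0Matrix ((matProd0 n B k).submatrix id (Fin.cast hn.symm)) := by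
  intro α
  have h := pathSystem_nonneg hfree hB (fun i : {x // x ∈ α} => (i : Fin (n 0)))
    Subtype.val_injective k le_rfl
    (Function.update (fun j _ => ⟨0, hpos j⟩) k fun i => Fin.cast hn.symm i)
    (fun j hj hkj => absurd hj hkj.not_gt) (fun i => by rw [Function.update_self])
  rw [Function.update_self] at h
  simpa [Matrix.submatrix_submatrix, Function.comp_def] using h
end

section
/- Let k ≥ 1 and let A^{(0)},...,A^{(k-1)} be real matrices with A^{(j)} of size n_j × n_{j+1} (indices mod k). Suppose there is an e-cycle of length km (given by injective maps v_j : Z/mZ → {1,...,n_j}) such that every nonzero entry of every A^{(j)} corresponds to an edge of this cycle; that is, A^{(j)}_{rs} ≠ 0 exactly when (r,s) = (v_j(t), v_{j+1}(t)) for some t (for j = 0,...,k-2), and A^{(k-1)}_{rs} ≠ 0 exactly when (r,s) = (v_{k-1}(t), v_0(t+1)) for some t. Then the product A = A^{(0)}A^{(1)}···A^{(k-1)} is not a P0-matrix; indeed the principal minor of A indexed by the image of v_0 is negative. -/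
theorem matProd0_apply_cycle {k : ℕ} {n : ℕ → ℕ}
    (A : ∀ j : ℕ, Matrix (Fin (n j)) (Fin (n (j + 1))) ℝ) {T : Type*}
    (v : ∀ j : ℕ, T → Fin (n j)) (hinj : ∀ j < k, Function.Injective (v j))
    (hsupp : ∀ j < k, ∀ (r : Fin (n j)) (s : Fin (n (j + 1))),
      A j r s ≠ 0 → ∃ t : T, r = v j t ∧ s = v (j + 1) t)
    (t : T) (l : ℕ) (hl : l ≤ k) (s : Fin (n l)) :
    matProd0 n A l (v 0 t) s =
      if s = v l t then ∏ j ∈ Finset.range l, A j (v j t) (v (j + 1) t) else 0 := by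
  induction l with
  | zero => simp [matProd0, Matrix.one_apply, eq_comm]
  | succ l ih =>
    have ih' := ih (by omega)
    simp only [matProd0, Matrix.mul_apply, ih', ite_mul, zero_mul, Finset.sum_ite_eq',
      Finset.mem_univ, if_true]
    split_ifs with h
    · rw [h, Finset.prod_range_succ]
    · refine mul_eq_zero_of_right _ ?_
      by_contra hne
      obtain ⟨t', h1, h2⟩ := hsupp l (by omega) _ _ hne
      exact h (hinj l (by omega) h1 ▸ h2)

theorem sign_addRight_one_zmod (m : ℕ) :
    Equiv.Perm.sign (Equiv.addRight (1 : ZMod (m + 1))) = (-1) ^ m := by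
  refine (Equiv.Perm.sign_eq_sign_of_equiv _ (finRotate (m + 1)) (ZMod.finEquiv (m + 1)).symm.toEquiv
    fun t => ?_).trans (sign_finRotate (m + 1))
  rw [finRotate_apply]
  exact map_add (ZMod.finEquiv (m + 1)).symm t 1

theorem det_of_shift (m : ℕ) (p : ZMod (m + 1) → ℝ) :
    (Matrix.of fun t t' : ZMod (m + 1) => if t' = t + 1 then p t else 0).det =
      (-1) ^ m * ∏ t, p t := by
  have h : (Matrix.of fun t t' : ZMod (m + 1) => if t' = t + 1 then p t else 0) =
      Matrix.diagonal p * (Equiv.addRight (1 : ZMod (m + 1))).permMatrix ℝ := by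
    ext t t'
    simp [Matrix.diagonal_mul, Equiv.Perm.permMatrix, PEquiv.toMatrix_apply, eq_comm]
  rw [h, Matrix.det_mul, Matrix.det_diagonal, Matrix.det_permutation, sign_addRight_one_zmod,
    mul_comm]
  simp

theorem stmt4 (k : ℕ) (hk : 1 ≤ k) (n : ℕ → ℕ) (hpos : ∀ j, 0 < n j)
    (hn : n k = n 0)
    (A : ∀ j : ℕ, Matrix (Fin (n j)) (Fin (n (j + 1))) ℝ)
    (m : ℕ) (v : ∀ j : ℕ, ZMod (m + 1) → Fin (n j))
    (hinj : ∀ j < k, Function.Injective (v j))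
    (hwrap : ∀ t : ZMod (m + 1), v k t = Fin.cast hn.symm (v 0 (t + 1)))
    (hexact : ∀ j < k, ∀ (r : Fin (n j)) (s : Fin (n (j + 1))),
      A j r s ≠ 0 ↔ ∃ t : ZMod (m + 1), r = v j t ∧ s = v (j + 1) t)
    (hsign : 0 < (-1 : ℝ) ^ (m + 1) *
        ∏ t : ZMod (m + 1), ∏ j ∈ Finset.range k, A j (v j t) (v (j + 1) t)) :
    (((matProd0 n A k).submatrix id (Fin.cast hn.symm)).submatrix
        (fun i : {x // x ∈ Finset.image (v 0) Finset.univ} => (i : Fin (n 0)))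
        (fun i : {x // x ∈ Finset.image (v 0) Finset.univ} => (i : Fin (n 0)))).det < 0 ∧
      ¬ IsP0Matrix ((matProd0 n A k).submatrix id (Fin.cast hn.symm)) := by
  have hdet : (((matProd0 n A k).submatrix id (Fin.cast hn.symm)).submatrix
        (fun i : {x // x ∈ Finset.image (v 0) Finset.univ} => (i : Fin (n 0)))
        (fun i : {x // x ∈ Finset.image (v 0) Finset.univ} => (i : Fin (n 0)))).det < 0 := by
    have hinj0 : Function.Injective (v 0) := hinj 0 hk
    let e : ZMod (m + 1) ≃ {x // x ∈ Finset.image (v 0) Finset.univ} :=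
      Equiv.ofBijective (fun t => ⟨v 0 t, Finset.mem_image_of_mem _ (Finset.mem_univ t)⟩)
        ⟨fun a b h => hinj0 (congrArg Subtype.val h), fun ⟨x, hx⟩ => by
          obtain ⟨t, -, rfl⟩ := Finset.mem_image.1 hx
          exact ⟨t, rfl⟩⟩
    rw [← Matrix.det_submatrix_equiv_self e]
    have hM : (((matProd0 n A k).submatrix id (Fin.cast hn.symm)).submatrix
        (fun i : {x // x ∈ Finset.image (v 0) Finset.univ} => (i : Fin (n 0)))
        (fun i : {x // x ∈ Finset.image (v 0) Finset.univ} => (i : Fin (n 0)))).submatrix e e =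
        Matrix.of fun t t' : ZMod (m + 1) => if t' = t + 1 then
          ∏ j ∈ Finset.range k, A j (v j t) (v (j + 1) t) else 0 := by
      ext t t'
      change matProd0 n A k (v 0 t) (Fin.cast hn.symm (v 0 t')) = _
      rw [matProd0_apply_cycle A v hinj (fun j hj r s => (hexact j hj r s).1) t k le_rfl, hwrap]
      simp only [Matrix.of_apply, (Fin.cast_injective hn.symm).eq_iff, hinj0.eq_iff]
    rw [hM, det_of_shift]
    rw [pow_succ] at hsign
    linarith
  exact ⟨hdet, fun h => absurd (h _) (not_le.2 hdet)⟩
end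

section
/- Let k ≥ 1 and let A^{(0)},...,A^{(k-1)} be real matrices with A^{(j)} of size n_j × n_{j+1} (indices mod k). If the associated signed digraph G_{A^{(0)}···A^{(k-1)}} contains an e-cycle, then there exist matrices B^{(j)} ∈ Q(A^{(j)}) for j = 0,...,k-1 such that the product B^{(0)}B^{(1)}···B^{(k-1)} is not a P0-matrix. -/
open Classical in
/-- The matrices obtained from `A` by scaling by `ε` all entries not on the cycle `v`. -/
noncomputable def dampOffCycle {ι : Type*} (n : ℕ → ℕ) (v : ∀ j : ℕ, ι → Fin (n j))
    (A : ∀ j : ℕ, Matrix (Fin (n j)) (Fin (n (j + 1))) ℝ) (ε : ℝ) (j : ℕ) :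
    Matrix (Fin (n j)) (Fin (n (j + 1))) ℝ :=
  fun a b => if ∃ t, a = v j t ∧ b = v (j + 1) t then A j a b else ε * A j a b

theorem inQualClass_dampOffCycle {ι : Type*} (n : ℕ → ℕ) (v : ∀ j : ℕ, ι → Fin (n j))
    (A : ∀ j : ℕ, Matrix (Fin (n j)) (Fin (n (j + 1))) ℝ) {ε : ℝ} (hε : 0 < ε) (j : ℕ) :
    InQualClass (dampOffCycle n v A ε j) (A j) := by
  intro a b
  unfold dampOffCycle
  split_ifs
  · exact ⟨id, id, id⟩
  · exact ⟨fun h => mul_pos hε h, fun h => mul_neg_of_pos_of_neg hε h, fun h => by rw [h, mul_zero]⟩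

theorem continuous_matProd0_dampOffCycle {ι : Type*} (n : ℕ → ℕ) (v : ∀ j : ℕ, ι → Fin (n j))
    (A : ∀ j : ℕ, Matrix (Fin (n j)) (Fin (n (j + 1))) ℝ) (l : ℕ) :
    Continuous fun ε => matProd0 n (dampOffCycle n v A ε) l := by
  induction l with
  | zero => exact continuous_const
  | succ l ih =>
    refine ih.matrix_mul (continuous_matrix fun a b => ?_)
    unfold dampOffCycle
    split_ifs <;> fun_prop

theorem matProd0_dampOffCycle_zero_apply {ι : Type*} (n : ℕ → ℕ) (v : ∀ j : ℕ, ι → Fin (n j))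
    (A : ∀ j : ℕ, Matrix (Fin (n j)) (Fin (n (j + 1))) ℝ) (t : ι) (l : ℕ)
    (hv : ∀ j < l, Function.Injective (v j)) (x : Fin (n l)) :
    matProd0 n (dampOffCycle n v A 0) l (v 0 t) x =
      if x = v l t then ∏ j ∈ Finset.range l, A j (v j t) (v (j + 1) t) else 0 := by
  induction l with
  | zero => simp [matProd0, Matrix.one_apply, eq_comm]
  | succ l ih =>
    have hinj := hv l l.lt_succ_self
    have hiff : (∃ s, v l t = v l s ∧ x = v (l + 1) s) ↔ x = v (l + 1) t :=
      ⟨fun ⟨s, hs, hx⟩ => by rw [hx, hinj hs], fun hx => ⟨t, rfl, hx⟩⟩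
    simp only [matProd0, Matrix.mul_apply, ih fun j hj => hv j (hj.trans l.lt_succ_self),
      ite_mul, zero_mul, Finset.sum_ite_eq', Finset.mem_univ, if_true, dampOffCycle, hiff]
    split_ifs with h
    · rw [Finset.prod_range_succ, h]
    · rw [mul_zero]

theorem det_weighted_cycle (m : ℕ) (w : ZMod (m + 1) → ℝ) :
    (Matrix.of fun s t : ZMod (m + 1) => if t = s + 1 then w s else 0).det =
      (-1) ^ m * ∏ t, w t := by
  have hsign : Equiv.Perm.sign (Equiv.addRight (1 : ZMod (m + 1))) = (-1) ^ m := by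
    have hrot : Equiv.addRight (1 : ZMod (m + 1)) = finRotate (m + 1) :=
      Equiv.ext fun s => (finRotate_apply (n := m + 1) s).symm
    rw [hrot]
    exact sign_finRotate (m + 1)
  have hfac : (Matrix.of fun s t : ZMod (m + 1) => if t = s + 1 then w s else 0) =
      Matrix.diagonal w * Equiv.Perm.permMatrix ℝ (Equiv.addRight (1 : ZMod (m + 1))) := by
    ext s t
    rw [Matrix.diagonal_mul, Equiv.Perm.permMatrix, PEquiv.toMatrix_apply]
    simp [eq_comm]
  rw [hfac, Matrix.det_mul, Matrix.det_diagonal, Matrix.det_permutation, hsign]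
  push_cast
  ring

theorem stmt6 (k : ℕ) (hk : 1 ≤ k) (n : ℕ → ℕ) (hpos : ∀ j, 0 < n j)
    (hn : n k = n 0)
    (A : ∀ j : ℕ, Matrix (Fin (n j)) (Fin (n (j + 1))) ℝ)
    (hcyc : HasECycle k n hn A) :
    ∃ B : ∀ j : ℕ, Matrix (Fin (n j)) (Fin (n (j + 1))) ℝ,
      (∀ j < k, InQualClass (B j) (A j)) ∧
      ¬ IsP0Matrix ((matProd0 n B k).submatrix id (Fin.cast hn.symm)) := by
  obtain ⟨m, v, hinj, hclose, -, hsign⟩ := hcyc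
  have hinj0 : Function.Injective (v 0) := hinj 0 hk
  let α : Finset (Fin (n 0)) := Finset.univ.image (v 0)
  let e : ZMod (m + 1) ≃ {x // x ∈ α} :=
    Equiv.ofBijective (fun t => ⟨v 0 t, Finset.mem_image_of_mem _ (Finset.mem_univ t)⟩)
      ⟨fun s t h => hinj0 (congrArg Subtype.val h), fun ⟨x, hx⟩ => by
        obtain ⟨t, -, rfl⟩ := Finset.mem_image.1 hx
        exact ⟨t, rfl⟩⟩
  let minor (ε : ℝ) : ℝ :=
    (((matProd0 n (dampOffCycle n v A ε) k).submatrix id (Fin.cast hn.symm)).submatrix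
      (fun i : {x // x ∈ α} => (i : Fin (n 0))) (fun i : {x // x ∈ α} => (i : Fin (n 0)))).det
  have hcont : Continuous minor :=
    (((continuous_matProd0_dampOffCycle n v A k).matrix_submatrix _ _).matrix_submatrix
      _ _).matrix_det
  have hminor : minor 0 < 0 := by
    have hval : minor 0 = (-1) ^ m *
        ∏ t : ZMod (m + 1), ∏ j ∈ Finset.range k, A j (v j t) (v (j + 1) t) := by
      rw [← det_weighted_cycle]
      simp only [minor]
      rw [← Matrix.det_submatrix_equiv_self e]
      congr 1
      ext s t
      have happly := matProd0_dampOffCycle_zero_apply n v A s k hinj (Fin.cast hn.symm (v 0 t))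
      rw [hclose s] at happly
      simp only [Fin.cast_inj, hinj0.eq_iff] at happly
      exact happly
    rw [hval]
    rw [pow_succ] at hsign
    linarith
  obtain ⟨ε, hneg, hε⟩ := ((hcont.continuousAt.eventually_lt_const hminor).filter_mono
    nhdsWithin_le_nhds |>.and (self_mem_nhdsWithin : Set.Ioi (0 : ℝ) ∈ nhdsWithin 0 _)).exists
  exact ⟨dampOffCycle n v A ε, fun j _ => inQualClass_dampOffCycle n v A hε j,
    fun hP0 => (hP0 α).not_gt hneg⟩
end

section
/- Let A be an n×n real matrix, let α be a nonempty subset of {1,...,n}, and let σ be a permutation of α such that A_{i,σ(i)} ≠ 0 for all i ∈ α. Let N_e be the number of orbits c of σ on α (including fixed points) such that (-1)^{|c|} · ∏_{i∈c} A_{i,σ(i)} > 0. Then the sign of the term T = sign(σ) · ∏_{i∈α} A_{i,σ(i)} equals (-1)^{N_e}; that is, T > 0 if N_e is even and T < 0 if N_e is odd. -/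
open scoped Classical

/-- The setoid on `β` whose classes are the orbits (cycles, including trivial ones) of the
permutation `σ`. -/
def sameCycleSetoid {β : Type*} (σ : Equiv.Perm β) : Setoid β :=
  ⟨σ.SameCycle, ⟨fun x => Equiv.Perm.SameCycle.refl σ x,
    fun h => h.symm, fun h h' => h.trans h'⟩⟩

/-- The orbit (as a finset) of `i` under the permutation `σ`. -/
noncomputable def orbitFinset {β : Type*} [Fintype β] (σ : Equiv.Perm β) (i : β) :
    Finset β :=
  Finset.univ.filter (fun j => σ.SameCycle i j)

/-- The number of orbits `c` of `σ` on `α` (including fixed points) such that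
`(-1) ^ |c| * ∏_{i ∈ c} A i (σ i) > 0`, i.e. the number of e-cycles in the subgraph of the
signed digraph of `A` determined by `σ`. -/
noncomputable def numECycles {n : ℕ} (A : Matrix (Fin n) (Fin n) ℝ) (α : Finset (Fin n))
    (σ : Equiv.Perm {x // x ∈ α}) : ℕ :=
  Nat.card {q : Quotient (sameCycleSetoid σ) //
    ∃ i : {x // x ∈ α}, Quotient.mk (sameCycleSetoid σ) i = q ∧
      0 < (-1 : ℝ) ^ (orbitFinset σ i).card *
          ∏ j ∈ orbitFinset σ i, A (j : Fin n) ((σ j : Fin n))}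

theorem mk_sameCycleSetoid_eq_iff {β : Type*} (σ : Equiv.Perm β) (i j : β) :
    Quotient.mk (sameCycleSetoid σ) i = Quotient.mk (sameCycleSetoid σ) j ↔ σ.SameCycle i j :=
  Quotient.eq

theorem sameCycle_out_mk {β : Type*} (σ : Equiv.Perm β) (i : β) :
    σ.SameCycle (Quotient.mk (sameCycleSetoid σ) i).out i :=
  (mk_sameCycleSetoid_eq_iff σ _ _).1 (Quotient.out_eq _)

theorem orbitFinset_eq_of_sameCycle {β : Type*} [Fintype β] {σ : Equiv.Perm β} {i j : β}
    (h : σ.SameCycle i j) : orbitFinset σ i = orbitFinset σ j := by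
  ext k
  simp only [orbitFinset, Finset.mem_filter, Finset.mem_univ, true_and]
  exact ⟨fun hk => h.symm.trans hk, fun hk => h.trans hk⟩

theorem sign_cycleOf_eq {β : Type*} [Fintype β] [DecidableEq β] (σ : Equiv.Perm β) (i : β) :
    Equiv.Perm.sign (σ.cycleOf i) = -(-1) ^ (orbitFinset σ i).card := by
  by_cases hi : σ i = i
  · have horbit : orbitFinset σ i = {i} := by
      ext k
      simp only [orbitFinset, Finset.mem_filter, Finset.mem_univ, true_and, Finset.mem_singleton]
      exact ⟨fun hk => (hk.eq_of_left hi).symm, fun hk => hk ▸ Equiv.Perm.SameCycle.refl σ i⟩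
    rw [(Equiv.Perm.cycleOf_eq_one_iff σ).2 hi, horbit]
    simp
  · rw [(Equiv.Perm.isCycle_cycleOf σ hi).sign]
    congr 3
    ext k
    simp [orbitFinset, Equiv.Perm.mem_support_cycleOf_iff' hi]

/-- The sign of a permutation is the product of the signs of its orbits. -/
theorem sign_eq_prod_orbits {β : Type*} [Fintype β] [DecidableEq β] (σ : Equiv.Perm β) :
    Equiv.Perm.sign σ =
      ∏ q : Quotient (sameCycleSetoid σ), -(-1) ^ (orbitFinset σ q.out).card := by
  have hσ : Equiv.Perm.sign σ = ∏ c ∈ σ.cycleFactorsFinset, Equiv.Perm.sign c := by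
    conv_lhs => rw [← σ.cycleFactorsFinset_noncommProd]
    rw [Finset.map_noncommProd, Finset.noncommProd_eq_prod]
    rfl
  simp_rw [hσ, ← sign_cycleOf_eq]
  symm
  refine Finset.prod_bij_ne_one (fun q _ _ => σ.cycleOf q.out) ?_ ?_ ?_ ?_
  · intro q _ hq
    rw [Equiv.Perm.cycleOf_mem_cycleFactorsFinset_iff, Equiv.Perm.mem_support]
    intro h
    exact hq (by rw [(Equiv.Perm.cycleOf_eq_one_iff σ).2 h, map_one])
  · intro q _ hq r _ _ h
    have hq' : σ q.out ≠ q.out := fun h =>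
      hq (by rw [(Equiv.Perm.cycleOf_eq_one_iff σ).2 h, map_one])
    have hmem : q.out ∈ (σ.cycleOf r.out).support := by
      rw [← h, Equiv.Perm.mem_support_cycleOf_iff' hq']
    rw [← Quotient.out_eq q, ← Quotient.out_eq r, mk_sameCycleSetoid_eq_iff]
    exact (Equiv.Perm.mem_support_cycleOf_iff.1 hmem).1.symm
  · intro c hc hc1
    obtain ⟨i, hi⟩ := (Equiv.Perm.mem_cycleFactorsFinset_iff.1 hc).1.nonempty_support
    have hci := Equiv.Perm.cycle_is_cycleOf hi hc
    have hout : σ.cycleOf (Quotient.mk (sameCycleSetoid σ) i).out = c := by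
      rw [hci, (sameCycle_out_mk σ i).cycleOf_eq]
    exact ⟨_, Finset.mem_univ _, by rwa [hout], hout⟩
  · intros
    rfl

theorem prod_eq_prod_orbits {β : Type*} [Fintype β] (σ : Equiv.Perm β) (f : β → ℝ) :
    ∏ i, f i = ∏ q : Quotient (sameCycleSetoid σ), ∏ i ∈ orbitFinset σ q.out, f i := by
  rw [← Finset.prod_fiberwise Finset.univ (Quotient.mk (sameCycleSetoid σ)) f]
  refine Finset.prod_congr rfl fun q _ => Finset.prod_congr ?_ fun _ _ => rfl
  ext i
  simp only [orbitFinset, Finset.mem_filter, Finset.mem_univ, true_and]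
  rw [← mk_sameCycleSetoid_eq_iff, Quotient.out_eq, eq_comm]

theorem sign_prod_neg {ι : Type*} [Fintype ι] (x : ι → ℝ) (hx : ∀ i, x i ≠ 0) :
    SignType.sign (∏ i, -x i) = (-1) ^ (Finset.univ.filter fun i => 0 < x i).card := by
  have hi (i : ι) : SignType.sign (-x i) = if 0 < x i then -1 else 1 := by
    split_ifs with h
    · exact sign_neg (neg_lt_zero.2 h)
    · exact sign_pos (neg_pos.2 (lt_of_le_of_ne (not_lt.1 h) (hx i)))
  change signHom (∏ i, -x i) = _
  rw [map_prod]
  change ∏ i, SignType.sign (-x i) = _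
  simp_rw [hi]
  rw [Finset.prod_ite, Finset.prod_const, Finset.prod_const_one, mul_one]

theorem numECycles_eq_card_filter {n : ℕ} (A : Matrix (Fin n) (Fin n) ℝ) (α : Finset (Fin n))
    (σ : Equiv.Perm {x // x ∈ α}) :
    numECycles A α σ = (Finset.univ.filter fun q : Quotient (sameCycleSetoid σ) =>
      0 < (-1 : ℝ) ^ (orbitFinset σ q.out).card *
        ∏ j ∈ orbitFinset σ q.out, A (j : Fin n) ((σ j : Fin n))).card := by
  rw [numECycles, Nat.card_eq_fintype_card, Fintype.card_subtype]
  congr 1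
  ext q
  simp only [Finset.mem_filter, Finset.mem_univ, true_and]
  constructor
  · rintro ⟨i, rfl, hi⟩
    rwa [orbitFinset_eq_of_sameCycle (sameCycle_out_mk σ i)]
  · exact fun h => ⟨q.out, Quotient.out_eq q, h⟩

theorem stmt10 {n : ℕ} (A : Matrix (Fin n) (Fin n) ℝ) (α : Finset (Fin n))
    (hα : α.Nonempty) (σ : Equiv.Perm {x // x ∈ α})
    (hnz : ∀ i : {x // x ∈ α}, A (i : Fin n) ((σ i : Fin n)) ≠ 0) :
    (Even (numECycles A α σ) →
        0 < ((Equiv.Perm.sign σ : ℤ) : ℝ) *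
            ∏ i : {x // x ∈ α}, A (i : Fin n) ((σ i : Fin n))) ∧
      (Odd (numECycles A α σ) →
        ((Equiv.Perm.sign σ : ℤ) : ℝ) *
            ∏ i : {x // x ∈ α}, A (i : Fin n) ((σ i : Fin n)) < 0) := by
  have hT : SignType.sign (((Equiv.Perm.sign σ : ℤ) : ℝ) *
      ∏ i : {x // x ∈ α}, A (i : Fin n) ((σ i : Fin n))) = (-1) ^ numECycles A α σ := by
    rw [numECycles_eq_card_filter, ← sign_prod_neg _ fun q => mul_ne_zero
      (pow_ne_zero _ (by norm_num)) (Finset.prod_ne_zero_iff.2 fun i _ => hnz i),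
      sign_eq_prod_orbits, prod_eq_prod_orbits σ]
    push_cast
    rw [← Finset.prod_mul_distrib]
    simp_rw [neg_mul]
  constructor
  · intro h
    rw [← sign_eq_one_iff, hT, h.neg_one_pow]
  · intro h
    rw [← sign_eq_neg_one_iff, hT, h.neg_one_pow]
end

section
/- Let A be an n×n real matrix, let α be a nonempty subset of {1,...,n}, and let σ be a permutation of α. Suppose that for every orbit c of σ on α (including fixed points) it is NOT the case that (-1)^{|c|} · ∏_{i∈c} A_{i,σ(i)} > 0. Then sign(σ) · ∏_{i∈α} A_{i,σ(i)} ≥ 0. -/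
open scoped Classical

/-- The sign of a permutation is the product of the signs of its cycle factors. -/
theorem Equiv.Perm.sign_eq_prod_cycleFactorsFinset {β : Type*} [Fintype β] [DecidableEq β]
    (σ : Equiv.Perm β) :
    Equiv.Perm.sign σ = ∏ c ∈ σ.cycleFactorsFinset, Equiv.Perm.sign c := by
  conv_lhs => rw [← σ.cycleFactorsFinset_noncommProd]
  rw [Finset.map_noncommProd, Finset.noncommProd_eq_prod]
  rfl

theorem Equiv.Perm.biUnion_support_cycleFactorsFinset {β : Type*} [Fintype β] [DecidableEq β]
    (σ : Equiv.Perm β) :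
    σ.cycleFactorsFinset.biUnion Equiv.Perm.support = σ.support := by
  ext i
  simp only [Finset.mem_biUnion]
  constructor
  · rintro ⟨c, hc, hi⟩
    exact Equiv.Perm.mem_cycleFactorsFinset_support_le hc hi
  · intro hi
    refine ⟨σ.cycleOf i, Equiv.Perm.cycleOf_mem_cycleFactorsFinset_iff.mpr hi, ?_⟩
    exact Equiv.Perm.mem_support_cycleOf_iff.mpr ⟨Equiv.Perm.SameCycle.refl σ i, hi⟩

theorem orbitFinset_eq_singleton {β : Type*} [Fintype β] {σ : Equiv.Perm β} {i : β}
    (hi : σ i = i) : orbitFinset σ i = {i} := by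
  ext j
  simp only [orbitFinset, Finset.mem_filter, Finset.mem_univ, true_and, Finset.mem_singleton]
  constructor
  · rintro ⟨k, rfl⟩
    exact Equiv.Perm.zpow_apply_eq_self_of_apply_eq_self hi k
  · rintro rfl
    exact Equiv.Perm.SameCycle.refl σ j

theorem orbitFinset_eq_support {β : Type*} [Fintype β] [DecidableEq β] {σ c : Equiv.Perm β}
    (hc : c ∈ σ.cycleFactorsFinset) {i : β} (hi : i ∈ c.support) :
    orbitFinset σ i = c.support := by
  have hiσ : i ∈ σ.support := Equiv.Perm.mem_cycleFactorsFinset_support_le hc hi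
  rw [Equiv.Perm.cycle_is_cycleOf hi hc]
  ext j
  simp only [orbitFinset, Finset.mem_filter, Finset.mem_univ, true_and,
    Equiv.Perm.mem_support_cycleOf_iff, hiσ, and_true]

/-- If no orbit `c` of `σ` satisfies `(-1) ^ |c| * ∏ j ∈ c, f j > 0`, then the product of `f`
over all points has the sign of `σ`, or vanishes. -/
theorem sign_mul_prod_nonneg_of_orbitFinset {β : Type*} [Fintype β] [DecidableEq β]
    (σ : Equiv.Perm β) (f : β → ℝ)
    (h : ∀ i, (-1 : ℝ) ^ (orbitFinset σ i).card * ∏ j ∈ orbitFinset σ i, f j ≤ 0) :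
    0 ≤ ((Equiv.Perm.sign σ : ℤ) : ℝ) * ∏ i, f i := by
  have hdisj : (σ.cycleFactorsFinset : Set (Equiv.Perm β)).PairwiseDisjoint
      Equiv.Perm.support := fun c hc d hd hcd =>
    (Equiv.Perm.cycleFactorsFinset_pairwise_disjoint σ hc hd hcd).disjoint_support
  rw [← Finset.prod_mul_prod_compl σ.support f, ← σ.biUnion_support_cycleFactorsFinset,
    Finset.prod_biUnion hdisj, σ.biUnion_support_cycleFactorsFinset,
    σ.sign_eq_prod_cycleFactorsFinset, ← mul_assoc]
  push_cast
  rw [← Finset.prod_mul_distrib]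
  refine mul_nonneg (Finset.prod_nonneg fun c hc => ?_) (Finset.prod_nonneg fun i hi => ?_)
  · have hcyc := (Equiv.Perm.mem_cycleFactorsFinset_iff.mp hc).1
    obtain ⟨i, hi⟩ := hcyc.nonempty_support
    have hle := h i
    rw [orbitFinset_eq_support hc hi] at hle
    rw [hcyc.sign]
    push_cast
    linarith
  · have hle := h i
    rw [orbitFinset_eq_singleton (Equiv.Perm.notMem_support.mp (Finset.mem_compl.mp hi))] at hle
    simpa using hle

theorem stmt11 {n : ℕ} (A : Matrix (Fin n) (Fin n) ℝ) (α : Finset (Fin n))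
    (hα : α.Nonempty) (σ : Equiv.Perm {x // x ∈ α})
    (hno : ∀ i : {x // x ∈ α},
      ¬ (0 < (-1 : ℝ) ^ (orbitFinset σ i).card *
            ∏ j ∈ orbitFinset σ i, A (j : Fin n) ((σ j : Fin n)))) :
    0 ≤ ((Equiv.Perm.sign σ : ℤ) : ℝ) *
        ∏ i : {x // x ∈ α}, A (i : Fin n) ((σ i : Fin n)) := by
  exact sign_mul_prod_nonneg_of_orbitFinset σ (fun i => A i (σ i))
    fun i => not_lt.mp (hno i)
end

section
/- Let a, b, c, d, e, f, g, h, w, x, y, z be arbitrary positive real numbers, and define the matrices A^{(0)} = [[a, -b, -c], [d, 0, e]] (2×3), A^{(1)} = [[f, 0], [-g, 0], [0, h]] (3×2), and A^{(2)} = [[w, x], [-y, z]] (2×2). Then the 2×2 product A^{(0)}A^{(1)}A^{(2)} is a P0-matrix: both of its diagonal entries and its determinant are nonnegative. -/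
theorem stmt13 (a b c d e f g h w x y z : ℝ)
    (ha : 0 < a) (hb : 0 < b) (hc : 0 < c) (hd : 0 < d) (he : 0 < e) (hf : 0 < f)
    (hg : 0 < g) (hh : 0 < h) (hw : 0 < w) (hx : 0 < x) (hy : 0 < y) (hz : 0 < z) :
    let A0 : Matrix (Fin 2) (Fin 3) ℝ := !![a, -b, -c; d, 0, e]
    let A1 : Matrix (Fin 3) (Fin 2) ℝ := !![f, 0; -g, 0; 0, h]
    let A2 : Matrix (Fin 2) (Fin 2) ℝ := !![w, x; -y, z]
    let M : Matrix (Fin 2) (Fin 2) ℝ := A0 * A1 * A2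
    0 ≤ M 0 0 ∧ 0 ≤ M 1 1 ∧ 0 ≤ M.det := by
  intro A0 A1 A2 M
  have hM : M = !![(a * f + b * g) * w + c * h * y, (a * f + b * g) * x - c * h * z;
      d * f * w - e * h * y, d * f * x + e * h * z] := by
    ext i j
    fin_cases i <;> fin_cases j <;>
      simp [M, A0, A1, A2] <;> ring
  have hdet : M.det = ((a * f + b * g) * (e * h) + c * h * (d * f)) * (w * z + x * y) := by
    rw [hM, Matrix.det_fin_two_of]
    ring
  refine ⟨?_, ?_, ?_⟩
  · rw [hM]
    change 0 ≤ (a * f + b * g) * w + c * h * y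
    positivity
  · rw [hM]
    change 0 ≤ d * f * x + e * h * z
    positivity
  · rw [hdet]
    positivity
end
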